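/- arXiv:math/0703305 — 4 statements merged into one kernel-verified Lean document; each statement's English description precedes it below -/
import Mathlib

section
/- Let m ≥ 1 be an integer and for each nonnegative integer k set T_k = ∏_p p^{⌊k/(p-1)⌋}, the product ranging over all prime numbers p (a finite product, since the exponent vanishes for p > k+1). If m_1, ..., m_r, m_{r+1}, ..., m_{r+s} are positive integers with m_1 + m_2 + ⋯ + m_r + m_{r+1} + ⋯ + m_{r+s} ≤ m, then the product (m_1+1)!⋯(m_r+1)! · T_{m_{r+1}} ⋯ T_{m_{r+s}} divides T_m. -/
/-- `T k = ∏_p p^{⌊k/(p-1)⌋}`, the product over all primes `p`; since the exponent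
vanishes for `p > k + 1`, it suffices to take the product over primes `p < k + 2`. -/
def ToddDenom (k : ℕ) : ℕ :=
  ∏ p ∈ (Finset.range (k + 2)).filter Nat.Prime, p ^ (k / (p - 1))

theorem toddDenom_ne_zero (k : ℕ) : ToddDenom k ≠ 0 := by
  unfold ToddDenom
  refine Finset.prod_ne_zero_iff.mpr fun p hp => pow_ne_zero _ ?_
  exact (Finset.mem_filter.mp hp).2.ne_zero

theorem toddDenom_factorization (k p : ℕ) (hp : p.Prime) :
    (ToddDenom k).factorization p = k / (p - 1) := by
  unfold ToddDenom
  rw [Nat.factorization_prod (fun q hq => pow_ne_zero _ (Finset.mem_filter.mp hq).2.ne_zero)]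
  rw [Finsupp.finsetSum_apply]
  have h : ∀ q ∈ (Finset.range (k + 2)).filter Nat.Prime,
      ((q ^ (k / (q - 1))).factorization) p = if q = p then k / (p - 1) else 0 := by
    intro q hq
    rw [(Finset.mem_filter.mp hq).2.factorization_pow, Finsupp.single_apply]
    split_ifs with h
    · rw [h]
    · rfl
  rw [Finset.sum_congr rfl h, Finset.sum_ite_eq']
  split_ifs with h
  · rfl
  · have : k + 2 ≤ p := by
      by_contra hlt
      exact h (Finset.mem_filter.mpr ⟨Finset.mem_range.mpr (by omega), hp⟩)
    exact (Nat.div_eq_of_lt (by omega)).symm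

theorem fact_bound (n p : ℕ) (hp : p.Prime) :
    (p - 1) * (Nat.factorial (n + 1)).factorization p ≤ n := by
  haveI := Fact.mk hp
  have := sub_one_mul_padicValNat_factorial_lt_of_ne_zero p (Nat.succ_ne_zero n)
  rw [Nat.factorization_def _ hp]
  exact Nat.lt_succ_iff.mp this

/-- If `m_1 + ⋯ + m_r + m_{r+1} + ⋯ + m_{r+s} ≤ m` with all `m_i` positive, then
`(m_1+1)! ⋯ (m_r+1)! · T_{m_{r+1}} ⋯ T_{m_{r+s}}` divides `T_m`. -/
theorem factorials_todd_divides (m r s : ℕ) (hm : 1 ≤ m)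
    (a : Fin r → ℕ) (b : Fin s → ℕ)
    (ha : ∀ i, 0 < a i) (hb : ∀ j, 0 < b j)
    (hsum : (∑ i, a i) + (∑ j, b j) ≤ m) :
    (∏ i, Nat.factorial (a i + 1)) * (∏ j, ToddDenom (b j)) ∣ ToddDenom m := by
  have h1 : (∏ i, Nat.factorial (a i + 1)) ≠ 0 :=
    Finset.prod_ne_zero_iff.mpr fun i _ => Nat.factorial_ne_zero _
  have h2 : (∏ j, ToddDenom (b j)) ≠ 0 :=
    Finset.prod_ne_zero_iff.mpr fun i _ => toddDenom_ne_zero _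
  rw [← Nat.factorization_prime_le_iff_dvd (mul_ne_zero h1 h2) (toddDenom_ne_zero m)]
  intro p hp
  rw [toddDenom_factorization m p hp, Nat.factorization_mul h1 h2,
    Nat.factorization_prod (fun i _ => Nat.factorial_ne_zero _),
    Nat.factorization_prod (fun i _ => toddDenom_ne_zero _), Finsupp.add_apply,
    Finsupp.finsetSum_apply, Finsupp.finsetSum_apply,
    Nat.le_div_iff_mul_le (by have := hp.two_le; omega), mul_comm, mul_add,
    Finset.mul_sum, Finset.mul_sum]
  refine le_trans (add_le_add (Finset.sum_le_sum fun i _ => fact_bound (a i) p hp)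
    (Finset.sum_le_sum fun j _ => ?_)) hsum
  rw [toddDenom_factorization _ p hp]
  exact Nat.mul_div_le _ _
end

section
/- Let N ≥ 1 and let k_1, ..., k_N be nonnegative integers with k_1 + ⋯ + k_N = m. Then the rational number T_m · ∏_{j=1}^N (B'_{k_j} / k_j!) is an integer, where B'_n denotes the n-th Bernoulli number with the convention B'_1 = +1/2. (This says that T_m clears the denominators of the degree-m homogeneous part of the Todd series ∏_{j=1}^N x_j/(1 - e^{-x_j}), i.e., that the numerator 𝔗𝔡_m = T_m·Td_m of the degree-m Todd polynomial has integral coefficients when expanded in the Chern roots x_1, ..., x_N.) -/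
theorem toddAux_ext (k M : ℕ) (h : k + 2 ≤ M) :
    ToddDenom k = ∏ p ∈ (Finset.range M).filter Nat.Prime, p ^ (k / (p - 1)) := by
  unfold ToddDenom
  apply Finset.prod_subset
  · intro p hp
    simp only [Finset.mem_filter, Finset.mem_range] at hp ⊢
    exact ⟨by omega, hp.2⟩
  · intro p hp hp'
    simp only [Finset.mem_filter, Finset.mem_range] at hp hp'
    have h1 : k + 2 ≤ p := by
      by_contra hc
      exact hp' ⟨by omega, hp.2⟩
    rw [Nat.div_eq_of_lt (by omega), pow_zero]

theorem toddAux_mul (a b : ℕ) : ToddDenom a * ToddDenom b ∣ ToddDenom (a + b) := by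
  rw [toddAux_ext a (a + b + 2) (by omega), toddAux_ext b (a + b + 2) (by omega),
    toddAux_ext (a + b) (a + b + 2) le_rfl, ← Finset.prod_mul_distrib]
  apply Finset.prod_dvd_prod_of_dvd
  intro p hp
  rw [← pow_add]
  exact pow_dvd_pow _ (Nat.div_add_div_le_add_div)

theorem toddAux_fact (n : ℕ) : (n + 1).factorial ∣ ToddDenom n := by
  have hM : n + 1 ≤ (n + 1).factorial := Nat.self_le_factorial _
  rw [toddAux_ext n ((n + 1).factorial + 1) (by omega)]
  conv_lhs => rw [← Nat.prod_pow_prime_padicValNat (n + 1).factorial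
    (Nat.factorial_ne_zero _) ((n + 1).factorial + 1) (Nat.lt_succ_self _)]
  apply Finset.prod_dvd_prod_of_dvd
  intro p hp
  have hpp : p.Prime := (Finset.mem_filter.mp hp).2
  haveI : Fact p.Prime := ⟨hpp⟩
  apply pow_dvd_pow
  rw [Nat.le_div_iff_mul_le (by have := hpp.two_le; omega), mul_comm,
    sub_one_mul_padicValNat_factorial]
  have : 0 < (Nat.digits p (n + 1)).sum := by
    by_contra hc
    have h0 : (Nat.digits p (n + 1)).sum = 0 := by omega
    rw [List.sum_eq_zero_iff] at h0
    have hne : Nat.digits p (n + 1) ≠ [] := Nat.digits_ne_nil_iff_ne_zero.mpr (by omega)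
    exact Nat.getLast_digit_ne_zero p (m := n + 1) (by omega) (h0 _ (List.getLast_mem hne))
  omega

theorem toddAux_rec (n : ℕ) : bernoulli' n / (n.factorial : ℚ) =
    1 / (n.factorial : ℚ) - ∑ j ∈ Finset.range n,
      bernoulli' j / (j.factorial : ℚ) * (1 / ((n - j + 1).factorial : ℚ)) := by
  have h := bernoulli'_spec n
  have hn : (n.factorial : ℚ) ≠ 0 := by exact_mod_cast Nat.factorial_ne_zero n
  have h2 : ∑ j ∈ Finset.range (n + 1),
      bernoulli' j / (j.factorial : ℚ) * (1 / ((n - j + 1).factorial : ℚ)) =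
      1 / (n.factorial : ℚ) := by
    refine Eq.trans ?_ (congrArg (fun t : ℚ => t / (n.factorial : ℚ)) h)
    beta_reduce
    rw [Finset.sum_div]
    apply Finset.sum_congr rfl
    intro j hj
    have hj' : j ≤ n := by simpa [Nat.lt_succ_iff] using hj
    have h3 := Nat.choose_mul_factorial_mul_factorial hj'
    have h3' : (n.choose j : ℚ) * j.factorial * (n - j).factorial = n.factorial := by
      exact_mod_cast h3
    have a1 : (j.factorial : ℚ) ≠ 0 := by exact_mod_cast Nat.factorial_ne_zero j
    have a2 : ((n - j).factorial : ℚ) ≠ 0 := by exact_mod_cast Nat.factorial_ne_zero _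
    have a3 : ((n : ℚ) - j + 1) ≠ 0 := by
      rw [← Nat.cast_sub hj']; positivity
    have a4 : (n.choose j : ℚ) ≠ 0 := by
      exact_mod_cast (Nat.choose_pos hj').ne'
    rw [Nat.choose_symm hj', Nat.factorial_succ, ← h3']
    push_cast [Nat.cast_sub hj']
    field_simp
  rw [Finset.sum_range_succ] at h2
  simp only [Nat.sub_self, zero_add, Nat.factorial_one, Nat.cast_one, div_one, mul_one] at h2
  linarith

theorem toddAux_one (n : ℕ) :
    ∃ z : ℤ, (ToddDenom n : ℚ) * (bernoulli' n / (n.factorial : ℚ)) = z := by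
  induction n using Nat.strong_induction_on with
  | _ n ih =>
    rw [toddAux_rec, mul_sub, Finset.mul_sum]
    have key : ∀ x : ℚ, (∃ z : ℤ, x = z) ↔ x ∈ (Int.castRingHom ℚ).range := by
      intro x
      simp [RingHom.mem_range, eq_comm]
    rw [key]
    apply Subring.sub_mem
    · rw [← key]
      obtain ⟨c, hc⟩ := (Nat.factorial_dvd_factorial (Nat.le_succ n)).trans (toddAux_fact n)
      refine ⟨c, ?_⟩
      have hn : (n.factorial : ℚ) ≠ 0 := by exact_mod_cast Nat.factorial_ne_zero n
      rw [hc]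
      push_cast
      field_simp
    · apply Subring.sum_mem
      intro j hj
      have hj' : j < n := Finset.mem_range.mp hj
      rw [← key]
      obtain ⟨z, hz⟩ := ih j hj'
      obtain ⟨c, hc⟩ := toddAux_fact (n - j)
      obtain ⟨d, hd⟩ := toddAux_mul j (n - j)
      rw [Nat.add_sub_cancel' hj'.le] at hd
      refine ⟨z * c * d, ?_⟩
      have hn : ((n - j + 1).factorial : ℚ) ≠ 0 := by exact_mod_cast Nat.factorial_ne_zero _
      rw [hd, hc]
      push_cast
      rw [← hz]
      generalize bernoulli' j / (j.factorial : ℚ) = b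
      field_simp

theorem toddAux_finset {ι : Type} (s : Finset ι) (k : ι → ℕ) :
    ∃ z : ℤ, (ToddDenom (∑ j ∈ s, k j) : ℚ) *
      ∏ j ∈ s, bernoulli' (k j) / (Nat.factorial (k j) : ℚ) = z := by
  classical
  induction s using Finset.induction_on with
  | empty => exact ⟨ToddDenom 0, by simp⟩
  | insert a s ha ih =>
    rw [Finset.sum_insert ha, Finset.prod_insert ha]
    obtain ⟨z, hz⟩ := ih
    obtain ⟨w, hw⟩ := toddAux_one (k a)
    obtain ⟨d, hd⟩ := toddAux_mul (k a) (∑ j ∈ s, k j)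
    refine ⟨w * z * d, ?_⟩
    rw [hd]
    push_cast
    rw [← hz, ← hw]
    ring

/-- If `k_1 + ⋯ + k_N = m` with `N ≥ 1`, then `T_m · ∏_j (B'_{k_j}/k_j!)` is an integer,
where `B'` are the Bernoulli numbers with the convention `B'_1 = +1/2`
(Mathlib's `bernoulli'`).  That is, `T_m` clears the denominators of the degree-`m`
part of the Todd series in the Chern roots. -/
theorem toddDenom_mul_todd_coeff_isInt (m N : ℕ) (hN : 1 ≤ N) (k : Fin N → ℕ)
    (hsum : ∑ j, k j = m) :
    ∃ z : ℤ, (ToddDenom m : ℚ) * ∏ j, bernoulli' (k j) / (Nat.factorial (k j) : ℚ) = z := by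
  subst hsum
  exact toddAux_finset Finset.univ k
end

section
/- Let m ≥ 1, let a ≥ 1 be an integer, let N ≥ 0, and let k_1, ..., k_N be nonnegative integers with a + k_1 + ⋯ + k_N = m. Then the rational number T_{m-1} · (1/a!) · ∏_{j=1}^N (B'_{k_j} / k_j!) is an integer, where B'_n denotes the n-th Bernoulli number with the convention B'_1 = +1/2. (This says that the polynomial Q_m = T_{m-1}·((1 - e^{-x})·Td)_m has integral coefficients when expanded in the variable x and the Chern roots x_1, ..., x_N: the coefficient of x^a · x_1^{k_1}⋯x_N^{k_N} in (1 - e^{-x})·∏_j x_j/(1 - e^{-x_j}) is ±(1/a!)·∏_j B'_{k_j}/k_j!, and T_{m-1} clears its denominator.) -/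
def ToddBd (p w : ℕ) (x : ℚ) : Prop := padicNorm p x ^ (p - 1) ≤ (p : ℚ) ^ w

theorem ToddBd.mul {p : ℕ} [Fact p.Prime] {w v : ℕ} {x y : ℚ} (hx : ToddBd p w x)
    (hy : ToddBd p v y) : ToddBd p (w + v) (x * y) := by
  unfold ToddBd at *
  rw [padicNorm.mul, mul_pow, pow_add]
  have := padicNorm.nonneg (p := p) y
  gcongr

theorem ToddBd.sub {p : ℕ} [Fact p.Prime] {w : ℕ} {x y : ℚ} (hx : ToddBd p w x)
    (hy : ToddBd p w y) : ToddBd p w (x - y) := by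
  unfold ToddBd at *
  have h := padicNorm.sub (p := p) (q := x) (r := y)
  have h0 := padicNorm.nonneg (p := p) (x - y)
  rcases le_max_iff.1 h with h | h
  · exact (pow_le_pow_left₀ h0 h _).trans hx
  · exact (pow_le_pow_left₀ h0 h _).trans hy

theorem ToddBd.zero {p : ℕ} [hp : Fact p.Prime] (w : ℕ) : ToddBd p w 0 := by
  unfold ToddBd
  have := hp.out.two_le
  rw [padicNorm.zero, zero_pow (by omega)]
  positivity

theorem ToddBd.sum {p : ℕ} [hp : Fact p.Prime] {w : ℕ} {ι : Type*} (s : Finset ι) (f : ι → ℚ)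
    (h : ∀ i ∈ s, ToddBd p w (f i)) : ToddBd p w (∑ i ∈ s, f i) := by
  classical
  induction s using Finset.induction_on with
  | empty => simpa using ToddBd.zero w
  | insert a s ha ih =>
    rw [Finset.sum_insert ha]
    have h1 := ih fun i hi => h i (Finset.mem_insert_of_mem hi)
    have h2 := h a (Finset.mem_insert_self _ _)
    have := h2.sub ((ToddBd.zero w).sub h1)
    simpa using this

theorem ToddBd.mono {p : ℕ} [hp : Fact p.Prime] {w v : ℕ} {x : ℚ} (hx : ToddBd p w x)
    (h : w ≤ v) : ToddBd p v x := by
  refine le_trans hx (pow_le_pow_right₀ ?_ h)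
  exact_mod_cast hp.out.one_lt.le

theorem ToddBd.prod {p : ℕ} [hp : Fact p.Prime] {ι : Type*} (s : Finset ι) (f : ι → ℚ) (w : ι → ℕ)
    (h : ∀ i ∈ s, ToddBd p (w i) (f i)) : ToddBd p (∑ i ∈ s, w i) (∏ i ∈ s, f i) := by
  classical
  induction s using Finset.induction_on with
  | empty => simp [ToddBd]
  | insert a s ha ih =>
    rw [Finset.sum_insert ha, Finset.prod_insert ha]
    exact (h a (Finset.mem_insert_self _ _)).mul (ih fun i hi => h i (Finset.mem_insert_of_mem hi))

theorem ToddBd.fact {p : ℕ} [hp : Fact p.Prime] (n : ℕ) :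
    ToddBd p n (1 / ((n + 1).factorial : ℚ)) := by
  have h := sub_one_mul_padicValNat_factorial_lt_of_ne_zero p (n := n + 1) (by omega)
  have hp0 : (p : ℚ) ≠ 0 := by exact_mod_cast hp.out.ne_zero
  unfold ToddBd
  rw [padicNorm.div, padicNorm.one, padicNorm.eq_zpow_of_nonzero (by positivity), padicValRat.of_nat,
    zpow_neg, one_div, inv_inv, zpow_natCast, ← pow_mul]
  apply pow_le_pow_right₀
  · exact_mod_cast hp.out.one_lt.le
  · rw [mul_comm]; omega

theorem ToddBd.bern {p : ℕ} [hp : Fact p.Prime] (n : ℕ) :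
    ToddBd p n (bernoulli' n / (n.factorial : ℚ)) := by
  induction n using Nat.strong_induction_on with
  | _ n ih =>
  have key : bernoulli' n / (n.factorial : ℚ) = 1 / (n.factorial : ℚ) -
      ∑ k ∈ Finset.range n, (bernoulli' k / (k.factorial : ℚ)) *
        (1 / ((n - k + 1).factorial : ℚ)) := by
    rw [bernoulli'_def, sub_div, Finset.sum_div]
    congr 1
    refine Finset.sum_congr rfl fun k hk => ?_
    have hk := Finset.mem_range.1 hk
    rw [Nat.cast_choose ℚ hk.le, Nat.factorial_succ]
    have h1 : ((n : ℚ) - k + 1) = ((n - k + 1 : ℕ) : ℚ) := by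
      push_cast [Nat.cast_sub hk.le]; ring
    rw [h1]
    have h2 : ((n - k + 1 : ℕ) : ℚ) ≠ 0 := by positivity
    have h3 : (n.factorial : ℚ) ≠ 0 := by positivity
    have h4 : (k.factorial : ℚ) ≠ 0 := by positivity
    have h5 : ((n - k).factorial : ℚ) ≠ 0 := by positivity
    rw [Nat.cast_mul]
    field_simp
  rw [key]
  refine ToddBd.sub ?_ (ToddBd.sum _ _ fun k hk => ?_)
  · rcases n with _ | n
    · simp [ToddBd]
    · exact (ToddBd.fact n).mono (by omega)
  · have hk := Finset.mem_range.1 hk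
    exact ((ih k hk).mul (ToddBd.fact (n - k))).mono (by omega)

theorem todd_int (q : ℚ) (h : ∀ p : ℕ, p.Prime → padicNorm p q ≤ 1) : ∃ z : ℤ, q = z := by
  refine ⟨q.num, ?_⟩
  have hd : q.den = 1 := by
    by_contra hne
    obtain ⟨p, hp, hpd⟩ := Nat.exists_prime_and_dvd hne
    haveI : Fact p.Prime := ⟨hp⟩
    have h1 : padicNorm p (q.den : ℚ) < 1 := (padicNorm.nat_lt_one_iff _).2 hpd
    have h2 : padicNorm p (q.num : ℚ) = 1 := by
      rw [padicNorm.int_eq_one_iff]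
      intro hn
      have := Nat.dvd_gcd (Int.natCast_dvd.1 hn) hpd
      rw [q.reduced.gcd_eq_one] at this
      exact hp.one_lt.ne' (Nat.dvd_one.1 this)
    rw [← Rat.mul_den_eq_num, padicNorm.mul] at h2
    have := h p hp
    have := padicNorm.nonneg (p := p) q
    have := padicNorm.nonneg (p := p) (q.den : ℚ)
    nlinarith
  exact (Rat.den_eq_one_iff q).1 hd |>.symm

theorem toddDenom_dvd (n p : ℕ) (hp : p.Prime) : p ^ (n / (p - 1)) ∣ ToddDenom n := by
  by_cases h : p < n + 2
  · exact Finset.dvd_prod_of_mem (fun p => p ^ (n / (p - 1))) (by simp [h, hp])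
  · rw [Nat.div_eq_of_lt (by omega)]; simp

theorem ToddBd.final {p : ℕ} [hp : Fact p.Prime] {w : ℕ} {x : ℚ} (hx : ToddBd p w x) :
    padicNorm p ((ToddDenom w : ℚ) * x) ≤ 1 := by
  by_cases h0 : x = 0
  · simp [h0]
  have h2 := hp.out.two_le
  have hp1 : (1 : ℚ) < p := by exact_mod_cast hp.out.one_lt
  have hT : padicNorm p (ToddDenom w : ℚ) ≤ (p : ℚ) ^ (-((w / (p - 1) : ℕ) : ℤ)) := by
    have := (padicNorm.dvd_iff_norm_le (p := p) (n := w / (p - 1)) (z := (ToddDenom w : ℤ))).1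
      (by exact_mod_cast toddDenom_dvd w p hp.out)
    simpa using this
  have hX : padicNorm p x ≤ (p : ℚ) ^ (((w / (p - 1) : ℕ) : ℤ)) := by
    have hlt : padicNorm p x < (p : ℚ) ^ (w / (p - 1) + 1) := by
      apply lt_of_pow_lt_pow_left₀ (p - 1) (by positivity)
      refine lt_of_le_of_lt hx ?_
      rw [← pow_mul]
      apply pow_lt_pow_right₀ hp1
      rw [mul_comm]
      exact Nat.lt_mul_div_succ w (by omega)
    rw [padicNorm.eq_zpow_of_nonzero h0, ← zpow_natCast, zpow_lt_zpow_iff_right₀ hp1] at hlt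
    rw [padicNorm.eq_zpow_of_nonzero h0, zpow_le_zpow_iff_right₀ hp1]
    push_cast at hlt ⊢
    omega
  rw [padicNorm.mul]
  calc _ ≤ (p : ℚ) ^ (-((w / (p - 1) : ℕ) : ℤ)) * (p : ℚ) ^ (((w / (p - 1) : ℕ) : ℤ)) :=
        mul_le_mul hT hX (padicNorm.nonneg _) (by positivity)
    _ = 1 := by rw [← zpow_add₀ (by positivity)]; simp

/-- If `a + k_1 + ⋯ + k_N = m` with `m ≥ 1` and `a ≥ 1`, then
`T_{m-1} · (1/a!) · ∏_j (B'_{k_j}/k_j!)` is an integer, where `B'` are the Bernoulli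
numbers with the convention `B'_1 = +1/2` (Mathlib's `bernoulli'`).  That is, the
polynomial `Q_m = T_{m-1}·((1 - e^{-x})·Td)_m` has integral coefficients when expanded
in `x` and the Chern roots. -/
theorem toddDenomPred_mul_Q_coeff_isInt (m a N : ℕ) (hm : 1 ≤ m) (ha : 1 ≤ a)
    (k : Fin N → ℕ) (hsum : a + ∑ j, k j = m) :
    ∃ z : ℤ, (ToddDenom (m - 1) : ℚ) * (1 / (Nat.factorial a : ℚ)) *
      ∏ j, bernoulli' (k j) / (Nat.factorial (k j) : ℚ) = z := by
  apply todd_int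
  intro p hp
  haveI : Fact p.Prime := ⟨hp⟩
  rw [mul_assoc]
  apply ToddBd.final
  obtain ⟨b, rfl⟩ : ∃ b, a = b + 1 := ⟨a - 1, by omega⟩
  exact ((ToddBd.fact b).mul (ToddBd.prod Finset.univ _ k fun j _ => ToddBd.bern (k j))).mono
    (by omega)
end

section
/- Let g ≥ 2 be an integer and set D_{2g} = ∏_{ℓ prime, (ℓ-1) | 2g} ℓ^{1 + v_ℓ(2g)}, where v_ℓ(2g) is the ℓ-adic valuation of 2g and the product is over all primes ℓ such that ℓ - 1 divides 2g. Then the integer 2·(g-1)!·D_{2g} divides T_{2g}. -/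
/-- `D_{2g} = ∏_{ℓ prime, (ℓ-1) ∣ 2g} ℓ^{1 + v_ℓ(2g)}`; a prime `ℓ` with `ℓ - 1 ∣ 2g`
satisfies `ℓ ≤ 2g + 1`, so it suffices to take the product over primes `ℓ < 2g + 2`. -/
def vonStaudtDenom (g : ℕ) : ℕ :=
  ∏ ℓ ∈ (Finset.range (2 * g + 2)).filter (fun ℓ => ℓ.Prime ∧ (ℓ - 1) ∣ 2 * g),
    ℓ ^ (1 + (2 * g).factorization ℓ)

theorem fact_prod_aux (s : Finset ℕ) (hs : ∀ p ∈ s, p.Prime) (f : ℕ → ℕ) (q : ℕ) :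
    (∏ p ∈ s, p ^ f p).factorization q = if q ∈ s then f q else 0 := by
  rw [Nat.factorization_prod (fun p hp => pow_ne_zero _ (hs p hp).ne_zero), Finset.sum_apply']
  rw [← Finset.sum_ite_eq s q f]
  refine Finset.sum_congr rfl fun p hp => ?_
  rw [(hs p hp).factorization_pow, Finsupp.single_apply]
  simp only [eq_comm]

theorem fact_bound_aux (p n : ℕ) (hp : p.Prime) (hn : 0 < n) :
    (p - 1) * (Nat.factorial n).factorization p + 1 ≤ n := by
  have := Fact.mk hp
  rw [Nat.factorization_def _ hp, sub_one_mul_padicValNat_factorial]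
  have h1 : 0 < (p.digits n).sum := by
    by_contra h
    have h0 : (p.digits n).sum = 0 := by omega
    have := Nat.getLast_digit_ne_zero p hn.ne'
    rw [List.sum_eq_zero_iff] at h0
    exact this (h0 _ (List.getLast_mem _))
  have := Nat.digit_sum_le p n
  omega

/-- For `g ≥ 2`, the integer `2·(g-1)!·D_{2g}` divides `T_{2g}`. -/
theorem ekedahl_vdGeer_dvd (g : ℕ) (hg : 2 ≤ g) :
    2 * Nat.factorial (g - 1) * vonStaudtDenom g ∣ ToddDenom (2 * g) := by
  have hf : Nat.factorial (g - 1) ≠ 0 := Nat.factorial_ne_zero _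
  have hD : vonStaudtDenom g ≠ 0 := by
    unfold vonStaudtDenom
    refine Finset.prod_ne_zero_iff.2 fun p hp => pow_ne_zero _ ?_
    exact (Finset.mem_filter.1 hp).2.1.ne_zero
  have hT : ToddDenom (2 * g) ≠ 0 := by
    unfold ToddDenom
    refine Finset.prod_ne_zero_iff.2 fun p hp => pow_ne_zero _ ?_
    exact (Finset.mem_filter.1 hp).2.ne_zero
  rw [← Nat.factorization_prime_le_iff_dvd (by positivity) hT]
  intro p hp
  have hp2 := hp.two_le
  have hTp : (ToddDenom (2 * g)).factorization p = 2 * g / (p - 1) := by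
    unfold ToddDenom
    rw [fact_prod_aux _ (fun p hp => (Finset.mem_filter.1 hp).2)]
    split_ifs with h
    · rfl
    · rw [Nat.div_eq_of_lt]
      simp only [Finset.mem_filter, Finset.mem_range, hp, and_true] at h
      omega
  have hDp : (vonStaudtDenom g).factorization p =
      if (p - 1) ∣ 2 * g then 1 + (2 * g).factorization p else 0 := by
    unfold vonStaudtDenom
    rw [fact_prod_aux _ (fun p hp => (Finset.mem_filter.1 hp).2.1)
      (fun p => 1 + (2 * g).factorization p)]
    refine if_congr ?_ rfl rfl
    simp only [Finset.mem_filter, Finset.mem_range, hp, true_and]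
    refine ⟨fun h => h.2, fun h => ⟨?_, h⟩⟩
    have := Nat.le_of_dvd (by omega) h
    omega
  rw [Nat.factorization_mul (by positivity) hD, Nat.factorization_mul (by norm_num) hf,
    Finsupp.add_apply, Finsupp.add_apply, hDp, hTp, Nat.prime_two.factorization,
    Finsupp.single_apply, Nat.factorization_mul (by norm_num) (by omega), Finsupp.add_apply,
    Nat.prime_two.factorization, Finsupp.single_apply]
  have hgf : (Nat.factorial g).factorization p =
      g.factorization p + (Nat.factorial (g - 1)).factorization p := by
    rw [← Nat.mul_factorial_pred (by omega : g ≠ 0), Nat.factorization_mul (by omega) hf,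
      Finsupp.add_apply]
  have hb := fact_bound_aux p g hp (by omega)
  have hb' := fact_bound_aux p (g - 1) hp (by omega)
  rw [Nat.le_div_iff_mul_le (by omega)]
  by_cases h2 : 2 = p
  · subst h2
    simp
    omega
  · rw [if_neg h2]
    split_ifs with hd
    · have hle := Nat.le_of_dvd (by omega) hd
      by_cases hpg : p ≤ g
      · rw [hgf] at hb
        obtain ⟨m, hm⟩ : ∃ m, m = p - 1 := ⟨_, rfl⟩
        rw [← hm] at hb ⊢
        have : m + 1 ≤ g := by omega
        nlinarith
      · have h0 : (Nat.factorial g).factorization p = 0 :=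
          Nat.factorization_factorial_eq_zero_of_lt (by omega)
        have h1 : g.factorization p = 0 := by omega
        have h3 : (Nat.factorial (g - 1)).factorization p = 0 := by omega
        rw [h1, h3]
        omega
    · rw [mul_comm] at hb'
      simp only [zero_add, add_zero]
      omega
end
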